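/- Let α ∈ {+,−,*}ⁿ have at least two * entries and no isolated * (every i with αᵢ = * has a neighbor j ∈ {i−1, i+1} ∩ [n] with α_j = *). Then the polytope P_α = conv{e_j − e_i : αᵢ ∈ {−,*}, α_j ∈ {+,*}, i ≠ j} is a hollow Bruhat polytope: there exist u ≤ v in Symₙ, with v having 2,…,n−1 in ascending order in one-line notation, such that P_α = conv of the vectors assigning −1 to coordinate x⁻¹(1) and +1 to coordinate x⁻¹(n) for x ∈ [u,v]. -/

import Mathlib

/-- The symbols `0, +, −, *` of a hollow symbol sequence. -/
inductive HollowSymbol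
  | zero
  | plus
  | minus
  | star
deriving DecidableEq

open HollowSymbol

/-- The number of inversions of a permutation of `Fin n` (its Coxeter length). -/
def invCount {n : ℕ} (σ : Equiv.Perm (Fin n)) : ℕ :=
  (Finset.univ.filter fun p : Fin n × Fin n => p.1 < p.2 ∧ σ p.2 < σ p.1).card

/-- The (strong) Bruhat order on the symmetric group `Symₙ`. -/
def BruhatLE {n : ℕ} (u v : Equiv.Perm (Fin n)) : Prop :=
  Relation.ReflTransGen
    (fun a b => invCount a < invCount b ∧
      ∃ i j : Fin n, i ≠ j ∧ b = a * Equiv.swap i j) u v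

/-- `v` is a minimal coset representative of hollow rank: the values `2,…,n−1`
appear in ascending order in the one-line notation of `v`. -/
def IsHollowMinRep {n : ℕ} (v : Equiv.Perm (Fin n)) : Prop :=
  ∀ a b : Fin n, a < b → (a : ℕ) ≠ 0 → (b : ℕ) ≠ n - 1 → v⁻¹ a < v⁻¹ b

/-- The vertex map sending `x ∈ Symₙ` to the vector with `−1` in coordinate
`x⁻¹(1)`, `+1` in coordinate `x⁻¹(n)` and `0` elsewhere. -/
def hollowVec {n : ℕ} (x : Equiv.Perm (Fin n)) : Fin n → ℝ :=
  fun p => (if (x p : ℕ) = n - 1 then 1 else 0) - (if (x p : ℕ) = 0 then 1 else 0)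

open Equiv in
theorem invCount_lt_mul_swap {n : ℕ} {x : Perm (Fin n)} {a b : Fin n} (hab : a < b)
    (h : x a < x b) : invCount x < invCount (x * swap a b) := by
  classical
  set s : Perm (Fin n) := swap a b with hs
  have hss : ∀ p, s (s p) = p := fun p => swap_apply_self a b p
  have hsp : ∀ p, (p = a ∧ s p = b) ∨ (p = b ∧ s p = a) ∨ (p ≠ a ∧ p ≠ b ∧ s p = p) := by
    intro p
    by_cases h1 : p = a
    · left; simp [h1, hs]
    by_cases h2 : p = b
    · right; left; simp [h2, hs]
    · right; right; exact ⟨h1, h2, swap_apply_of_ne_of_ne h1 h2⟩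
  set T := Finset.univ.filter fun p : Fin n × Fin n => p.1 < p.2 ∧ (x * s) p.2 < (x * s) p.1
  have hT : (a, b) ∈ T := by simp [T, hab, hs, h]
  let g : Fin n × Fin n → Fin n × Fin n := fun p => if s p.1 < s p.2 then (s p.1, s p.2) else p
  refine lt_of_le_of_lt (Finset.card_le_card_of_injOn (t := T.erase (a, b)) g ?_ ?_)
    (Finset.card_erase_lt_of_mem hT)
  · rintro ⟨p, q⟩ hpq
    obtain ⟨hlt, hinv⟩ := (Finset.mem_filter.mp hpq).2
    rw [Finset.mem_coe, Finset.mem_erase]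
    by_cases hc : s p < s q
    · have hne : ¬ (s p = a ∧ s q = b) := by
        rintro ⟨h1, h2⟩
        have h3 : p = b := by rw [← hss p, h1]; simp [hs]
        have h4 : q = a := by rw [← hss q, h2]; simp [hs]
        subst h3 h4
        exact absurd hlt (not_lt.mpr hab.le)
      rw [show g (p, q) = (s p, s q) from if_pos hc]
      refine ⟨by simpa using hne, Finset.mem_filter.mpr ⟨Finset.mem_univ _, hc, ?_⟩⟩
      simpa only [Perm.mul_apply, hss] using hinv
    · have hne : ¬ (p = a ∧ q = b) := by
        rintro ⟨rfl, rfl⟩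
        exact absurd hinv (not_lt.mpr h.le)
      have : x (s q) < x (s p) := by
        rcases hsp p with ⟨h1, h2⟩ | ⟨h1, h2⟩ | ⟨h1, h1', h2⟩ <;>
        rcases hsp q with ⟨h3, h4⟩ | ⟨h3, h4⟩ | ⟨h3, h3', h4⟩ <;> rw [h2, h4] at hc ⊢ <;>
        grind
      rw [show g (p, q) = (p, q) from if_neg hc]
      exact ⟨by simpa using hne, Finset.mem_filter.mpr ⟨Finset.mem_univ _, hlt, this⟩⟩
  · rintro ⟨p, q⟩ hpq ⟨p', q'⟩ hpq' heq
    replace hpq := (Finset.mem_filter.mp hpq).2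
    replace hpq' := (Finset.mem_filter.mp hpq').2
    simp only [g] at heq
    split_ifs at heq with h1 h2 h2
    · simpa using heq
    · obtain ⟨rfl, rfl⟩ := Prod.mk.inj heq
      simp [hss] at h2
      exact absurd hpq.1 (not_lt.mpr h2)
    · obtain ⟨rfl, rfl⟩ := Prod.mk.inj heq
      simp [hss] at h1
      exact absurd hpq'.1 (not_lt.mpr h1)
    · exact heq

/-- The number of the first `k` positions at which `x` takes a value at least `j`. -/
def prefixRank {n : ℕ} (x : Equiv.Perm (Fin n)) (k j : ℕ) : ℕ :=
  (Finset.univ.filter fun c : Fin n => (c : ℕ) < k ∧ j ≤ (x c : ℕ)).card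

theorem prefixRank_zero {n : ℕ} (x : Equiv.Perm (Fin n)) (j : ℕ) : prefixRank x 0 j = 0 := by
  simp [prefixRank]

theorem prefixRank_succ {n : ℕ} (x : Equiv.Perm (Fin n)) (c : Fin n) (j : ℕ) :
    prefixRank x (c + 1) j = prefixRank x c j + if j ≤ (x c : ℕ) then 1 else 0 := by
  classical
  unfold prefixRank
  split_ifs with h
  · rw [← Finset.card_insert_of_notMem (a := c) (by simp)]
    congr 1
    ext d
    simp only [Finset.mem_filter, Finset.mem_univ, true_and, Finset.mem_insert, Fin.ext_iff]
    constructor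
    · rintro ⟨h1, h2⟩; by_cases h3 : (d : ℕ) = c
      · exact Or.inl h3
      · exact Or.inr ⟨by omega, h2⟩
    · rintro (h1 | ⟨h1, h2⟩)
      · obtain rfl : d = c := Fin.ext h1
        exact ⟨by omega, h⟩
      · exact ⟨by omega, h2⟩
  · rw [add_zero]
    congr 1
    ext d
    simp only [Finset.mem_filter, Finset.mem_univ, true_and]
    constructor
    · rintro ⟨h1, h2⟩
      refine ⟨?_, h2⟩
      by_contra h3
      obtain rfl : d = c := Fin.ext (by omega)
      exact h h2
    · rintro ⟨h1, h2⟩; exact ⟨by omega, h2⟩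

open Equiv in
theorem prefixRank_mul_swap {n : ℕ} {x : Perm (Fin n)} {a b : Fin n} (hab : a < b)
    (h : x a < x b) (k j : ℕ) :
    prefixRank (x * swap a b) k j =
      prefixRank x k j + if (a : ℕ) < k ∧ k ≤ b ∧ (x a : ℕ) < j ∧ j ≤ (x b : ℕ) then 1 else 0 := by
  induction k with
  | zero => simp [prefixRank_zero]
  | succ k ih =>
    by_cases hk : k < n
    · have e1 := prefixRank_succ (x * swap a b) ⟨k, hk⟩ j
      have e2 := prefixRank_succ x ⟨k, hk⟩ j
      simp only at e1 e2
      rw [e1, e2, ih]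
      have hab' : (a : ℕ) < b := hab
      have h' : (x a : ℕ) < x b := h
      rw [Perm.mul_apply]
      by_cases h1 : (⟨k, hk⟩ : Fin n) = a
      · have : k = a := congrArg Fin.val h1
        rw [h1, swap_apply_left]
        split_ifs <;> omega
      by_cases h2 : (⟨k, hk⟩ : Fin n) = b
      · have : k = b := congrArg Fin.val h2
        rw [h2, swap_apply_right]
        split_ifs <;> omega
      · rw [swap_apply_of_ne_of_ne h1 h2]
        have h3 : k ≠ a := fun e => h1 (Fin.ext e)
        have h4 : k ≠ b := fun e => h2 (Fin.ext e)
        split_ifs <;> omega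
    · have e : ∀ y : Perm (Fin n), prefixRank y (k + 1) j = prefixRank y k j := by
        intro y
        unfold prefixRank
        congr 1
        ext d
        have := d.2
        simp only [Finset.mem_filter, Finset.mem_univ, true_and]
        constructor <;> rintro ⟨_, h⟩ <;> exact ⟨by omega, h⟩
      rw [e, e, ih]
      have := b.2
      split_ifs <;> omega

open Equiv in
theorem BruhatLE.prefixRank_le {n : ℕ} {x y : Perm (Fin n)} (h : BruhatLE x y) (k j : ℕ) :
    prefixRank x k j ≤ prefixRank y k j := by
  have key : ∀ (z : Perm (Fin n)) (a b : Fin n), a < b → invCount z < invCount (z * swap a b) →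
      prefixRank z k j ≤ prefixRank (z * swap a b) k j := by
    intro z a b hab hlt
    have hz : z a < z b := by
      by_contra hcon
      have hne : z b ≠ z a := fun e => hab.ne (z.injective e).symm
      have h1 : (z * swap a b) a < (z * swap a b) b := by
        simpa using lt_of_le_of_ne (not_lt.mp hcon) hne
      have h2 := invCount_lt_mul_swap hab h1
      rw [mul_assoc, swap_mul_self, mul_one] at h2
      omega
    rw [prefixRank_mul_swap hab hz]
    omega
  induction h with
  | refl => exact le_rfl
  | tail _ hstep ih =>
    obtain ⟨hlt, a, b, hab, rfl⟩ := hstep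
    refine ih.trans ?_
    rcases lt_or_gt_of_ne hab with h | h
    · exact key _ a b h hlt
    · rw [swap_comm] at hlt ⊢
      exact key _ b a h hlt

open Equiv in
/-- If `x ≠ y` is dominated by `y` in all prefix ranks, some transposition step up from `x` is
still dominated by `y`. -/
theorem exists_swap_prefixRank_le {n : ℕ} {x y : Perm (Fin n)}
    (h : ∀ k j, prefixRank x k j ≤ prefixRank y k j) (hne : x ≠ y) :
    ∃ a b : Fin n, a < b ∧ x a < x b ∧
      ∀ k j, prefixRank (x * swap a b) k j ≤ prefixRank y k j := by
  classical
  obtain ⟨a, ha, hmin⟩ : ∃ a, x a ≠ y a ∧ ∀ c < a, x c = y c := by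
    have hex : (Finset.univ.filter fun c => x c ≠ y c).Nonempty := by
      by_contra hcon
      rw [Finset.not_nonempty_iff_eq_empty, Finset.filter_eq_empty_iff] at hcon
      exact hne (Equiv.ext fun c => not_not.mp (hcon (Finset.mem_univ c)))
    refine ⟨_, (Finset.mem_filter.mp (Finset.min'_mem _ hex)).2, fun c hc => ?_⟩
    by_contra hcon
    exact absurd (Finset.min'_le _ c (by simpa using hcon)) (not_le.mpr hc)
  have hpre : ∀ k j, k ≤ (a : ℕ) → prefixRank x k j = prefixRank y k j := by
    intro k j hk
    unfold prefixRank
    congr 1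
    ext c
    simp only [Finset.mem_filter, Finset.mem_univ, true_and]
    refine and_congr_right fun hc => ?_
    rw [hmin c (Fin.lt_def.mpr (by omega))]
  have hlt : x a < y a := by
    refine lt_of_le_of_ne ?_ ha
    have h1 := h (a + 1) (x a)
    rw [prefixRank_succ, prefixRank_succ, hpre a _ le_rfl] at h1
    by_contra hcon
    rw [if_pos le_rfl, if_neg (by simpa using hcon)] at h1
    omega
  obtain ⟨b, hb, hbmin⟩ : ∃ b, (a < b ∧ x a < x b ∧ x b ≤ y a) ∧
      ∀ c, a < c → c < b → x a < x c → y a < x c := by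
    have hex : (Finset.univ.filter fun c => a < c ∧ x a < x c ∧ x c ≤ y a).Nonempty := by
      refine ⟨x.symm (y a), ?_⟩
      simp only [Finset.mem_filter, Finset.mem_univ, true_and, Equiv.apply_symm_apply, le_refl,
        and_true, hlt]
      by_contra hcon
      rcases lt_or_eq_of_le (not_lt.mp hcon) with h1 | h1
      · have := hmin _ h1
        rw [Equiv.apply_symm_apply] at this
        exact h1.ne (y.injective this.symm)
      · have h2 := x.apply_symm_apply (y a)
        rw [h1] at h2
        exact ha h2
    refine ⟨_, (Finset.mem_filter.mp (Finset.min'_mem _ hex)).2, fun c h1 h2 h3 => ?_⟩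
    by_contra hcon
    exact absurd (Finset.min'_le _ c (by simpa [h1, h3] using hcon)) (not_le.mpr h2)
  refine ⟨a, b, hb.1, hb.2.1, fun k j => ?_⟩
  rw [prefixRank_mul_swap hb.1 hb.2.1]
  split_ifs with hc
  swap
  · exact h k j
  obtain ⟨hak, hkb, hj1, hj2⟩ := hc
  have hya : (x b : ℕ) ≤ y a := hb.2.2
  have hsplit : ∀ (z : Perm (Fin n)), prefixRank z k j = prefixRank z k (y a + 1) +
      (Finset.univ.filter fun c : Fin n => (c : ℕ) < k ∧ j ≤ (z c : ℕ) ∧ (z c : ℕ) ≤ y a).card := by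
    intro z
    unfold prefixRank
    rw [← Finset.card_union_of_disjoint]
    · congr 1
      ext c
      simp only [Finset.mem_filter, Finset.mem_univ, true_and, Finset.mem_union]
      omega
    · rw [Finset.disjoint_filter]
      intro c _ h1 h2
      omega
  rw [hsplit x, hsplit y, add_assoc]
  refine add_le_add (h k _) (Nat.succ_le_of_lt (Finset.card_lt_card ?_))
  rw [Finset.ssubset_iff_of_subset]
  · refine ⟨a, ?_, ?_⟩
    · simp only [Finset.mem_filter, Finset.mem_univ, true_and]
      omega
    · simp only [Finset.mem_filter, Finset.mem_univ, true_and]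
      omega
  · intro c hc
    simp only [Finset.mem_filter, Finset.mem_univ, true_and] at hc ⊢
    have hca : c < a := by
      by_contra hcon
      rcases lt_or_eq_of_le (not_lt.mp hcon) with h1 | h1
      · have h2 := hbmin c h1 (Fin.lt_def.mpr (by omega)) (Fin.lt_def.mpr (by omega))
        have h3 : (y a : ℕ) < x c := h2
        omega
      · rw [← h1] at hc
        omega
    rw [← hmin c hca]
    exact hc

/-- The rank criterion for the Bruhat order. -/
theorem bruhatLE_of_prefixRank_le {n : ℕ} {x y : Equiv.Perm (Fin n)}
    (h : ∀ k j, prefixRank x k j ≤ prefixRank y k j) : BruhatLE x y := by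
  have hbound : ∀ z : Equiv.Perm (Fin n), invCount z ≤ n * n := fun z =>
    (Finset.card_le_univ _).trans (by simp)
  induction hd : n * n - invCount x using Nat.strong_induction_on generalizing x with
  | _ d ih =>
    by_cases hne : x = y
    · rw [hne]; exact Relation.ReflTransGen.refl
    obtain ⟨a, b, hab, hx, hle⟩ := exists_swap_prefixRank_le h hne
    have hlt := invCount_lt_mul_swap hab hx
    have := hbound (x * Equiv.swap a b)
    exact Relation.ReflTransGen.head ⟨hlt, a, b, hab.ne, rfl⟩ (ih _ (by omega) hle rfl)

/-- Data of a chain of prefix sets: prefix `k` is `{0,…,k-1}` when `L k`, and otherwise it is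
`{0,…,k-1}` with the last element of `A` below `k` traded for the first element of `B` from `k`
on. The transition conditions make consecutive prefix sets differ by one element. -/
structure PrefixData (n : ℕ) where
  A : ℕ → Prop
  B : ℕ → Prop
  L : ℕ → Prop
  A_zero : A 0
  B_last : B (n - 1)
  L_zero : L 0
  L_of_le : ∀ k, n ≤ k → L k
  not_both : ∀ k, ¬ L k → ¬ L (k + 1) → A k → ¬ B k
  A_of_L : ∀ k, L k → ¬ L (k + 1) → A k
  B_of_L : ∀ k, ¬ L k → L (k + 1) → B k

namespace PrefixData

open Classical in
/-- The largest element of `A` below `k`. -/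
noncomputable def low {n : ℕ} (P : PrefixData n) (k : ℕ) : ℕ := Nat.findGreatest P.A (k - 1)

/-- The smallest element of `B` that is at least `k`. -/
noncomputable def high {n : ℕ} (P : PrefixData n) (k : ℕ) : ℕ := sInf {j | k ≤ j ∧ P.B j}

open Classical in
/-- The `k`-th prefix set. -/
noncomputable def pre {n : ℕ} (P : PrefixData n) (k : ℕ) : Finset ℕ :=
  if P.L k then Finset.range k else insert (P.high k) ((Finset.range k).erase (P.low k))

open Classical in
/-- The element added in passing from prefix `k` to prefix `k + 1`. -/
noncomputable def val {n : ℕ} (P : PrefixData n) (k : ℕ) : ℕ :=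
  if P.L k then (if P.L (k + 1) then k else P.high (k + 1))
  else if P.L (k + 1) then P.low k
  else if P.B k then P.high (k + 1) else if P.A k then P.low k else k

variable {n : ℕ} (P : PrefixData n)

theorem A_low (k : ℕ) : P.A (P.low k) := by
  classical
  exact Nat.findGreatest_spec (P := P.A) (Nat.zero_le _) P.A_zero

theorem low_lt {k : ℕ} (hk : 0 < k) : P.low k < k := by
  classical
  have : P.low k ≤ k - 1 := Nat.findGreatest_le _
  omega

theorem le_low {k j : ℕ} (hj : j < k) (h : P.A j) : j ≤ P.low k := by
  classical
  exact Nat.le_findGreatest (by omega) h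

theorem low_eq {k j : ℕ} (hj : j < k) (h : P.A j) (hmax : ∀ i, j < i → i < k → ¬ P.A i) :
    P.low k = j := by
  have h1 := P.le_low hj h
  have h2 := P.low_lt (k := k) (by omega)
  by_contra hne
  exact hmax _ (by omega) h2 (P.A_low k)

theorem high_spec {k : ℕ} (hk : k < n) : k ≤ P.high k ∧ P.B (P.high k) :=
  Nat.sInf_mem (s := {j | k ≤ j ∧ P.B j}) ⟨n - 1, by omega, P.B_last⟩

theorem high_le {k j : ℕ} (hj : k ≤ j) (h : P.B j) : P.high k ≤ j := Nat.sInf_le ⟨hj, h⟩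

theorem high_eq {k j : ℕ} (hk : k < n) (hj : k ≤ j) (h : P.B j)
    (hmin : ∀ i, k ≤ i → i < j → ¬ P.B i) : P.high k = j := by
  have h1 := P.high_le hj h
  have h2 := P.high_spec hk
  by_contra hne
  exact hmin _ h2.1 (by omega) h2.2

theorem high_lt {k : ℕ} (hk : k < n) : P.high k < n := by
  have := P.high_le (k := k) (j := n - 1) (by omega) P.B_last
  omega

theorem lt_of_not_L {k : ℕ} (h : ¬ P.L k) : 0 < k ∧ k < n := by
  refine ⟨Nat.pos_of_ne_zero fun e => h (e ▸ P.L_zero), ?_⟩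
  by_contra hc
  exact h (P.L_of_le k (by omega))

theorem low_succ_of_A {k : ℕ} (h : P.A k) : P.low (k + 1) = k :=
  P.low_eq (by omega) h (by omega)

theorem low_succ_of_not_A {k : ℕ} (hk : 0 < k) (h : ¬ P.A k) : P.low (k + 1) = P.low k := by
  have h1 := P.low_lt hk
  refine P.low_eq (by omega) (P.A_low k) fun i h2 h3 h4 => ?_
  by_cases hi : i = k
  · exact h (hi ▸ h4)
  · have := P.le_low (by omega : i < k) h4
    omega

theorem high_of_B {k : ℕ} (hk : k < n) (h : P.B k) : P.high k = k :=
  P.high_eq hk le_rfl h (by omega)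

theorem high_succ_of_not_B {k : ℕ} (hk : k < n) (h : ¬ P.B k) : P.high (k + 1) = P.high k := by
  have h1 := P.high_spec hk
  have h2 : P.high k ≠ k := fun e => h (e ▸ h1.2)
  have h3 := P.high_lt hk
  refine P.high_eq (by omega) (by omega) h1.2 fun i h4 h5 h6 => ?_
  have := P.high_le (by omega : k ≤ i) h6
  omega

theorem mem_pre {k y : ℕ} : y ∈ P.pre k ↔
    (P.L k ∧ y < k) ∨ (¬ P.L k ∧ (y = P.high k ∨ (y < k ∧ y ≠ P.low k))) := by
  unfold pre
  split_ifs with h <;> simp [h]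
  tauto

theorem val_notMem {k : ℕ} (hk : k < n) : P.val k ∉ P.pre k := by
  rw [mem_pre]
  unfold val
  by_cases h : P.L k <;> by_cases h' : P.L (k + 1)
  · simp [h, h']
  · have h1 := P.lt_of_not_L h'
    have := P.high_spec h1.2
    simp [h, h']
    omega
  · have h1 := P.lt_of_not_L h
    have h2 := P.high_spec h1.2
    have h3 := P.low_lt h1.1
    simp [h, h']
    omega
  · have h1 := P.lt_of_not_L h
    have h1' := P.lt_of_not_L h'
    have h2 := P.high_spec h1.2
    have h2' := P.high_spec h1'.2
    have h3 := P.low_lt h1.1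
    by_cases hB : P.B k
    · have := P.high_of_B hk hB
      simp [h, h', hB]
      omega
    · have h2 : P.high k ≠ k := fun e => hB (e ▸ h2.2)
      by_cases hA : P.A k
      · simp [h, h', hB, hA]
        omega
      · simp [h, h', hB, hA]
        omega

theorem pre_succ {k : ℕ} (hk : k < n) : P.pre (k + 1) = insert (P.val k) (P.pre k) := by
  ext y
  rw [Finset.mem_insert, mem_pre, mem_pre]
  unfold val
  by_cases h : P.L k <;> by_cases h' : P.L (k + 1)
  · simp [h, h']
    omega
  · have hA := P.low_succ_of_A (P.A_of_L k h h')
    simp [h, h', hA]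
    omega
  · have h1 := P.lt_of_not_L h
    have h3 := P.low_lt h1.1
    have hB := P.high_of_B hk (P.B_of_L k h h')
    simp [h, h', hB]
    omega
  · have h1 := P.lt_of_not_L h
    have h2 := P.high_spec h1.2
    have h3 := P.low_lt h1.1
    by_cases hB : P.B k
    · have h4 := P.high_of_B hk hB
      have h5 := P.low_succ_of_not_A h1.1 (fun hA => P.not_both k h h' hA hB)
      simp [h, h', hB, h4, h5]
      omega
    · have h4 : P.high k ≠ k := fun e => hB (e ▸ h2.2)
      have h5 := P.high_succ_of_not_B hk hB
      by_cases hA : P.A k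
      · have h6 := P.low_succ_of_A hA
        simp [h, h', hB, hA, h5, h6]
        omega
      · have h6 := P.low_succ_of_not_A h1.1 hA
        simp [h, h', hB, hA, h5, h6]
        omega

theorem pre_zero : P.pre 0 = ∅ := by simp [pre, P.L_zero]

theorem pre_subset {k l : ℕ} (hkl : k ≤ l) (hl : l ≤ n) : P.pre k ⊆ P.pre l := by
  induction l, hkl using Nat.le_induction with
  | base => exact subset_rfl
  | succ l _ ih =>
    rw [P.pre_succ (by omega)]
    exact (ih (by omega)).trans (Finset.subset_insert _ _)

theorem val_mem_pre {k l : ℕ} (hkl : k < l) (hl : l ≤ n) : P.val k ∈ P.pre l := by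
  refine P.pre_subset (k := k + 1) hkl hl ?_
  rw [P.pre_succ (by omega)]
  exact Finset.mem_insert_self _ _

theorem val_lt {k : ℕ} (hk : k < n) : P.val k < n := by
  have h := P.val_mem_pre hk le_rfl
  rw [pre, if_pos (P.L_of_le n le_rfl)] at h
  exact Finset.mem_range.mp h

theorem val_injective : Function.Injective fun k : Fin n => (⟨P.val k, P.val_lt k.2⟩ : Fin n) := by
  have key : ∀ k l : Fin n, k < l → P.val k ≠ P.val l := fun k l hkl e =>
    P.val_notMem l.2 (e ▸ P.val_mem_pre (Fin.lt_def.mp hkl) l.2.le)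
  intro k l hkl
  have h : P.val k = P.val l := congrArg Fin.val hkl
  rcases lt_trichotomy k l with h1 | h1 | h1
  · exact absurd h (key k l h1)
  · exact h1
  · exact absurd h.symm (key l k h1)

/-- The permutation whose prefix sets are `P.pre`. -/
noncomputable def perm : Equiv.Perm (Fin n) :=
  Equiv.ofBijective _ (Finite.injective_iff_bijective.mp P.val_injective)

theorem perm_apply (k : Fin n) : (P.perm k : ℕ) = P.val k := rfl

theorem prefixRank_perm {k : ℕ} (hk : k ≤ n) (j : ℕ) :
    prefixRank P.perm k j = ((P.pre k).filter (j ≤ ·)).card := by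
  induction k with
  | zero => simp [prefixRank_zero, pre_zero]
  | succ k ih =>
    have h : prefixRank P.perm (k + 1) j =
        prefixRank P.perm k j + if j ≤ P.val k then 1 else 0 := prefixRank_succ P.perm ⟨k, hk⟩ j
    rw [h, ih (by omega), P.pre_succ hk, Finset.filter_insert]
    split_ifs with hj
    · rw [Finset.card_insert_of_notMem]
      intro hmem
      exact P.val_notMem hk (Finset.mem_filter.mp hmem).1
    · rw [add_zero]

theorem card_filter_range (k j : ℕ) : ((Finset.range k).filter (j ≤ ·)).card = k - j := by
  rw [show (Finset.range k).filter (j ≤ ·) = Finset.Ico j k by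
    ext y; simp only [Finset.mem_filter, Finset.mem_range, Finset.mem_Ico]; omega]
  simp

theorem prefixRank_perm_of_L {k : ℕ} (hk : k ≤ n) (h : P.L k) (j : ℕ) :
    prefixRank P.perm k j = k - j := by
  rw [P.prefixRank_perm hk, pre, if_pos h, card_filter_range]

theorem prefixRank_perm_of_not_L {k : ℕ} (h : ¬ P.L k) (j : ℕ) :
    prefixRank P.perm k j + (if j ≤ P.low k then 1 else 0) =
      k - j + if j ≤ P.high k then 1 else 0 := by
  obtain ⟨h1, h2⟩ := P.lt_of_not_L h
  have h3 := P.high_spec h2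
  have h4 := P.low_lt h1
  rw [P.prefixRank_perm h2.le, pre, if_neg h, Finset.filter_insert, Finset.filter_erase,
    ← card_filter_range]
  have hmem : P.high k ∉ ((Finset.range k).filter (j ≤ ·)).erase (P.low k) := by
    simp only [Finset.mem_erase, Finset.mem_filter, Finset.mem_range]
    omega
  have hcard : (((Finset.range k).filter (j ≤ ·)).erase (P.low k)).card +
      (if j ≤ P.low k then 1 else 0) = ((Finset.range k).filter (j ≤ ·)).card := by
    split_ifs with hj
    · exact Finset.card_erase_add_one (by simp [h4, hj])
    · rw [Finset.erase_eq_of_notMem (by simp [hj]), add_zero]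
  split_ifs at hcard ⊢
  all_goals try rw [Finset.card_insert_of_notMem hmem]
  all_goals omega

theorem prefixRank_of_le {x : Equiv.Perm (Fin n)} {k : ℕ} (hk : n ≤ k) (j : ℕ) :
    prefixRank x k j = prefixRank x n j := by
  unfold prefixRank
  congr 1
  ext c
  have := c.2
  simp only [Finset.mem_filter, Finset.mem_univ, true_and]
  omega

/-- Shrinking the data moves the permutation up in the Bruhat order. -/
theorem bruhatLE_perm {P Q : PrefixData n} (hA : ∀ k < n, Q.A k → P.A k)
    (hB : ∀ k < n, Q.B k → P.B k) (hL : ∀ k < n, Q.L k → P.L k) : BruhatLE P.perm Q.perm := by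
  have key : ∀ k ≤ n, ∀ j, prefixRank P.perm k j ≤ prefixRank Q.perm k j := by
    intro k hk j
    by_cases hP : P.L k
    · rw [P.prefixRank_perm_of_L hk hP]
      by_cases hQ : Q.L k
      · rw [Q.prefixRank_perm_of_L hk hQ]
      · have h := Q.prefixRank_perm_of_not_L hQ j
        obtain ⟨h1, h2⟩ := Q.lt_of_not_L hQ
        have h3 := Q.high_spec h2
        have h4 := Q.low_lt h1
        split_ifs at h <;> omega
    · obtain ⟨h1, h2⟩ := P.lt_of_not_L hP
      have hQ : ¬ Q.L k := fun e => hP (hL k h2 e)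
      have hp := P.prefixRank_perm_of_not_L hP j
      have hq := Q.prefixRank_perm_of_not_L hQ j
      have h3 := P.high_spec h2
      have h4 := P.low_lt h1
      have h5 := P.le_low (Q.low_lt h1) (hA _ ((Q.low_lt h1).trans h2) (Q.A_low k))
      have h6 := P.high_le (Q.high_spec h2).1 (hB _ (Q.high_lt h2) (Q.high_spec h2).2)
      split_ifs at hp hq <;> omega
  refine bruhatLE_of_prefixRank_le fun k j => ?_
  by_cases hk : k ≤ n
  · exact key k hk j
  · rw [prefixRank_of_le (by omega : n ≤ k), prefixRank_of_le (by omega : n ≤ k)]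
    exact key n le_rfl j

end PrefixData

/-- The data whose permutation has the value `n` at the smallest position `p` and the value `1` at
the largest position `q`, and is ascending elsewhere. -/
def topData {n p q : ℕ} (hpq : p < q) : PrefixData n where
  A k := k = 0 ∨ q ≤ k
  B k := k ≤ p ∨ k = n - 1
  L k := k = 0 ∨ n ≤ k
  A_zero := by simp
  B_last := by simp
  L_zero := by simp
  L_of_le := by omega
  not_both := by omega
  A_of_L := by omega
  B_of_L := by omega

theorem isHollowMinRep_topData {n p q : ℕ} (hpq : p < q) (hq : q < n) :
    IsHollowMinRep (topData hpq (n := n)).perm := by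
  intro a b hab ha hb
  set P := topData hpq (n := n) with hP
  have hA : ∀ k, P.A k ↔ k = 0 ∨ q ≤ k := fun k => Iff.rfl
  have hB : ∀ k, P.B k ↔ k ≤ p ∨ k = n - 1 := fun k => Iff.rfl
  have hL : ∀ k, P.L k ↔ k = 0 ∨ n ≤ k := fun k => Iff.rfl
  by_contra hcon
  have hab' : (a : ℕ) < b := hab
  set l := P.perm⁻¹ a with hl
  set k := P.perm⁻¹ b with hk
  have hla : P.perm l = a := P.perm.apply_symm_apply a
  have hkb : P.perm k = b := P.perm.apply_symm_apply b
  have hva : P.val l = a := congrArg Fin.val hla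
  have hvb : P.val k = b := congrArg Fin.val hkb
  have hkl : (k : ℕ) < l := by
    rcases lt_or_eq_of_le (not_lt.mp hcon) with h | h
    · exact h
    · rw [h, hla] at hkb
      exact absurd hkb hab.ne
  have hln := l.2
  have hmem : (b : ℕ) ∈ P.pre (k + 1) := hvb ▸ P.val_mem_pre (by omega) (by omega)
  have hnot : (a : ℕ) ∉ P.pre (k + 1) := fun h =>
    P.val_notMem l.2 (hva ▸ P.pre_subset (by omega) (by omega) h)
  rw [P.mem_pre, hL] at hmem hnot
  have h1 := P.high_spec (k := k + 1) (by omega)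
  have h2 := P.low_lt (k := k + 1) (by omega)
  have h3 := P.A_low (k + 1)
  have h4 : ∀ j, (k : ℕ) + 1 ≤ j → P.B j → P.high (k + 1) ≤ j := fun j => P.high_le
  have h5 : ∀ j, j < (k : ℕ) + 1 → P.A j → j ≤ P.low (k + 1) := fun j => P.le_low
  have h6 := h4 (k + 1)
  have h7 := h5 k
  rw [hB] at h1 h6
  rw [hA] at h3 h7
  have hbn := b.2
  omega

/-- The data of a permutation with the value `1` at position `i` and the value `n` at position `j`,
lying below that of `topData`. -/
def vertexData {n p q i j : ℕ} (hpq : p < q) (_hq : q < n) (hi : i ≤ q) (hj : p ≤ j) (hjn : j < n)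
    (hij : i ≠ j) : PrefixData n where
  A k := k = 0 ∨ q ≤ k ∨ k = i ∨ (k = i + 1 ∧ i ≤ p)
  B k := k ≤ p ∨ k = n - 1 ∨ k = j ∨ (k + 1 = j ∧ q ≤ j)
  L k := k = 0 ∨ n ≤ k ∨ (k = i + 1 ∧ i ≤ p) ∨ (k = j ∧ q ≤ j)
  A_zero := by simp
  B_last := by simp
  L_zero := by simp
  L_of_le := by omega
  not_both := by omega
  A_of_L := by omega
  B_of_L := by omega

section vertexData

variable {n p q i j : ℕ} (hpq : p < q) (hq : q < n) (hi : i ≤ q) (hj : p ≤ j) (hjn : j < n)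
  (hij : i ≠ j)

theorem vertexData_val_left : (vertexData hpq hq hi hj hjn hij).val i = 0 := by
  set P := vertexData hpq hq hi hj hjn hij
  have hA : ∀ k, P.A k ↔ k = 0 ∨ q ≤ k ∨ k = i ∨ (k = i + 1 ∧ i ≤ p) := fun k => Iff.rfl
  have hB : ∀ k, P.B k ↔ k ≤ p ∨ k = n - 1 ∨ k = j ∨ (k + 1 = j ∧ q ≤ j) := fun k => Iff.rfl
  have hL : ∀ k, P.L k ↔ k = 0 ∨ n ≤ k ∨ (k = i + 1 ∧ i ≤ p) ∨ (k = j ∧ q ≤ j) :=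
    fun k => Iff.rfl
  have hlow : 0 < i → P.low i = 0 := fun h =>
    P.low_eq h P.A_zero fun k h1 h2 => by rw [hA]; omega
  have h1 := hL i
  have h2 := hL (i + 1)
  have h3 := hA i
  have h4 := hB i
  unfold PrefixData.val
  split_ifs <;> simp_all <;> omega

theorem vertexData_val_right : (vertexData hpq hq hi hj hjn hij).val j = n - 1 := by
  set P := vertexData hpq hq hi hj hjn hij
  have hA : ∀ k, P.A k ↔ k = 0 ∨ q ≤ k ∨ k = i ∨ (k = i + 1 ∧ i ≤ p) := fun k => Iff.rfl
  have hB : ∀ k, P.B k ↔ k ≤ p ∨ k = n - 1 ∨ k = j ∨ (k + 1 = j ∧ q ≤ j) := fun k => Iff.rfl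
  have hL : ∀ k, P.L k ↔ k = 0 ∨ n ≤ k ∨ (k = i + 1 ∧ i ≤ p) ∨ (k = j ∧ q ≤ j) :=
    fun k => Iff.rfl
  have hhigh : j + 1 < n → P.high (j + 1) = n - 1 := fun h =>
    P.high_eq h (by omega) P.B_last fun k h1 h2 => by rw [hB]; omega
  have h1 := hL j
  have h2 := hL (j + 1)
  have h3 := hA j
  have h4 := hB j
  unfold PrefixData.val
  split_ifs <;> simp_all <;> omega

end vertexData

/-- The data of the minimum of the interval, for the sets `A` and `B` of positions permitted for
the values `1` and `n`, where `p = min B` and `q = max A`. -/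
def bottomData {n p q : ℕ} (A B : ℕ → Prop) (hpq : p < q) (hq : q < n) (hqA : A q)
    (hiso : ∀ k, A k → B k → A (k + 1) ∧ B (k + 1) ∨ ∃ l, k = l + 1 ∧ A l ∧ B l) :
    PrefixData n where
  A k := A k ∨ k = 0 ∨ q ≤ k ∨ k = p
  B k := B k ∨ k ≤ p ∨ k = n - 1 ∨ k = q
  L k := k ≤ p ∨ q < k ∨ ∃ l, k = l + 1 ∧ (A l ∧ B l) ∧ A k ∧ B k
  A_zero := by simp
  B_last := by simp
  L_zero := by simp
  L_of_le := by omega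
  not_both := by
    intro k h1 h2 hA hB
    push Not at h1 h2
    have hA' : A k := by
      rcases hA with h | h | h | h
      · exact h
      · omega
      · obtain rfl : k = q := by omega
        exact hqA
      · omega
    have hB' : B k := by
      rcases hB with h | h | h | h
      · exact h
      · omega
      · omega
      · omega
    rcases hiso k hA' hB' with h | ⟨l, rfl, h⟩
    · exact h2.2.2 k rfl ⟨hA', hB'⟩ h.1 h.2
    · exact h1.2.2 l rfl h hA' hB'
  A_of_L := by
    rintro k (h | h | ⟨l, rfl, _, h, _⟩) h2
    · push Not at h2
      omega
    · omega
    · exact Or.inl h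
  B_of_L := by
    rintro k h1 (h | h | ⟨l, hl, h, _⟩)
    · omega
    · push Not at h1
      omega
    · obtain rfl : k = l := by omega
      exact Or.inl h.2

theorem prefixRank_topData {n p q : ℕ} (hpq : p < q) {k : ℕ} (hk : 0 < k) (hkn : k < n) (j : ℕ) :
    prefixRank (topData hpq (n := n)).perm k j + (if j ≤ (if k ≤ q then 0 else k - 1) then 1 else 0)
      = k - j + if j ≤ (if k ≤ p then k else n - 1) then 1 else 0 := by
  set P := topData hpq (n := n)
  have hL : ¬ P.L k := by
    change ¬ (k = 0 ∨ n ≤ k)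
    omega
  have hlow : P.low k = if k ≤ q then 0 else k - 1 := by
    split_ifs with h
    · refine P.low_eq hk P.A_zero fun i h1 h2 h3 => ?_
      change i = 0 ∨ q ≤ i at h3
      omega
    · exact P.low_eq (by omega) (Or.inr (by omega)) fun i h1 h2 => by omega
  have hhigh : P.high k = if k ≤ p then k else n - 1 := by
    split_ifs with h
    · exact P.high_of_B hkn (Or.inl h)
    · refine P.high_eq hkn (by omega) P.B_last fun i h1 h2 h3 => ?_
      change i ≤ p ∨ i = n - 1 at h3
      omega
  rw [← hlow, ← hhigh]
  exact P.prefixRank_perm_of_not_L hL j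

theorem mem_left_of_interval {n p q : ℕ} {A B : ℕ → Prop} (hpq : p < q) (hq : q < n)
    (hqA : A q)
    (hiso : ∀ k, A k → B k → A (k + 1) ∧ B (k + 1) ∨ ∃ l, k = l + 1 ∧ A l ∧ B l)
    (hcover : ∀ k < n, A k ∨ B k) (hp : ∀ k, B k → p ≤ k)
    {x : Equiv.Perm (Fin n)}
    (hu : ∀ k j, prefixRank (bottomData A B hpq hq hqA hiso).perm k j ≤ prefixRank x k j)
    (hv : ∀ k j, prefixRank x k j ≤ prefixRank (topData hpq (n := n)).perm k j)
    (k : Fin n) (hk : (x k : ℕ) = 0) : A k := by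
  by_contra hA
  have hkn := k.2
  have hB : B k := (hcover k hkn).resolve_left hA
  have hpk := hp k hB
  have hkq : (k : ℕ) ≠ q := fun e => hA (e ▸ hqA)
  have hstep : ∀ j, prefixRank x (k + 1) j = prefixRank x k j + if j ≤ 0 then 1 else 0 := by
    intro j
    rw [prefixRank_succ, hk]
  by_cases hkq' : q < k
  · have h1 := hstep 1
    have h0 := hstep 0
    have h2 := hv k 1
    have h3 := prefixRank_topData hpq (n := n) (k := k) (by omega) hkn 1
    have h4 : prefixRank x k 1 = k := by
      have h5 : ∀ l ≤ (k : ℕ), prefixRank x l 1 = l := by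
        intro l
        induction l with
        | zero => intro _; exact prefixRank_zero _ _
        | succ l ih =>
          intro hl
          have h6 := prefixRank_succ x ⟨l, by omega⟩ 1
          have h7 : (x ⟨l, by omega⟩ : ℕ) ≠ 0 := by
            intro e
            have h8 : (⟨l, by omega⟩ : Fin n) = k := x.injective (Fin.ext (e.trans hk.symm))
            have h9 : l = k := congrArg Fin.val h8
            omega
          rw [if_pos (by omega)] at h6
          simp only at h6
          rw [h6, ih (by omega)]
      exact h5 k le_rfl
    split_ifs at h3 <;> omega
  set P := bottomData A B hpq hq hqA hiso
  have hL : ¬ P.L (k + 1) := by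
    rintro (h | h | ⟨l, hl, h, _⟩)
    · omega
    · omega
    · obtain rfl : (k : ℕ) = l := by omega
      exact hA h.1
  obtain ⟨h1, h2⟩ := P.lt_of_not_L hL
  have h3 := P.high_spec h2
  have h4 := P.low_lt h1
  by_cases hkp : (k : ℕ) = p
  · have h5 := P.prefixRank_perm_of_not_L hL (k + 1)
    have h6 := hu (k + 1) (k + 1)
    have h7 := hstep (k + 1)
    have h8 := hv k (k + 1)
    by_cases hk0 : (k : ℕ) = 0
    · rw [hk0, prefixRank_zero] at h7
      rw [hk0] at h5 h6 h3 h4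
      split_ifs at h5 h7 <;> omega
    · have h9 := prefixRank_topData hpq (n := n) (k := k) (by omega) hkn (k + 1)
      split_ifs at h5 h7 h9 <;> omega
  · have hlow : P.low (k + 1) ≠ k := by
      intro e
      have := P.A_low (k + 1)
      rw [e] at this
      rcases this with h | h | h | h
      · exact hA h
      all_goals omega
    have h5 := P.prefixRank_perm_of_not_L hL k
    have h6 := hu (k + 1) k
    have h7 := hstep k
    have h8 := hv k k
    have h9 := prefixRank_topData hpq (n := n) (k := k) (by omega) hkn k
    split_ifs at h5 h7 h9 <;> omega

theorem mem_right_of_interval {n p q : ℕ} {A B : ℕ → Prop} (hpq : p < q) (hq : q < n)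
    (hqA : A q) (hpB : B p)
    (hiso : ∀ k, A k → B k → A (k + 1) ∧ B (k + 1) ∨ ∃ l, k = l + 1 ∧ A l ∧ B l)
    (hcover : ∀ k < n, A k ∨ B k) (hqm : ∀ k, A k → k ≤ q)
    {x : Equiv.Perm (Fin n)}
    (hu : ∀ k j, prefixRank (bottomData A B hpq hq hqA hiso).perm k j ≤ prefixRank x k j)
    (hv : ∀ k j, prefixRank x k j ≤ prefixRank (topData hpq (n := n)).perm k j)
    (k : Fin n) (hk : (x k : ℕ) = n - 1) : B k := by
  by_contra hB
  have hkn := k.2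
  have hA : A k := (hcover k hkn).resolve_right hB
  have hkq := hqm k hA
  have hkp : (k : ℕ) ≠ p := fun e => hB (e ▸ hpB)
  have hstep : ∀ j < n, prefixRank x (k + 1) j = prefixRank x k j + 1 := by
    intro j hj
    rw [prefixRank_succ, hk, if_pos (by omega)]
  by_cases hkp' : (k : ℕ) < p
  · have h1 := hstep (n - 1) (by omega)
    have h2 := hv (k + 1) (n - 1)
    have h3 := prefixRank_topData hpq (n := n) (k := k + 1) (by omega) (by omega) (n - 1)
    split_ifs at h3 <;> omega
  set P := bottomData A B hpq hq hqA hiso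
  have hL : ¬ P.L k := by
    rintro (h | h | ⟨l, hl, _, h⟩)
    · omega
    · omega
    · exact hB h.2
  obtain ⟨h1, h2⟩ := P.lt_of_not_L hL
  have h3 := P.high_spec h2
  have h4 := P.low_lt h1
  by_cases hkq' : (k : ℕ) = q
  · have h5 := P.prefixRank_perm_of_not_L hL k
    have h6 := hu k k
    have h7 := hstep k hkn
    have h8 := hv (k + 1) k
    by_cases hk1 : (k : ℕ) + 1 = n
    · have h9 := (topData hpq (n := n)).prefixRank_perm_of_L le_rfl (Or.inr le_rfl) k
      rw [hk1] at h8 h7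
      split_ifs at h5 <;> omega
    · have h9 := prefixRank_topData hpq (n := n) (k := k + 1) (by omega) (by omega) k
      split_ifs at h5 h9 <;> omega
  · have hhigh : P.high k ≠ k := by
      intro e
      have := h3.2
      rw [e] at this
      rcases this with h | h | h | h
      · exact hB h
      all_goals omega
    have h5 := P.prefixRank_perm_of_not_L hL (k + 1)
    have h6 := hu k (k + 1)
    have h7 := hstep (k + 1) (by omega)
    have h8 := hv (k + 1) (k + 1)
    have h9 := prefixRank_topData hpq (n := n) (k := k + 1) (by omega) (by omega) (k + 1)
    split_ifs at h5 h9 <;> omega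

theorem bruhatLE_bottomData_vertexData {n p q i j : ℕ} {A B : ℕ → Prop} (hpq : p < q)
    (hq : q < n) (hqA : A q) (hpB : B p)
    (hiso : ∀ k, A k → B k → A (k + 1) ∧ B (k + 1) ∨ ∃ l, k = l + 1 ∧ A l ∧ B l)
    (hcover : ∀ k < n, A k ∨ B k) (hp : ∀ k, B k → p ≤ k) (hqm : ∀ k, A k → k ≤ q)
    (hA : A i) (hB : B j) (hjn : j < n) (hij : i ≠ j) :
    BruhatLE (bottomData A B hpq hq hqA hiso).perm
      (vertexData hpq hq (hqm i hA) (hp j hB) hjn hij).perm := by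
  have hi1 : i = p → A (i + 1) ∧ B (i + 1) := by
    rintro rfl
    rcases hiso i hA hpB with h | ⟨l, hl, -, h⟩
    · exact h
    · have := hp l h
      omega
  have hj1 : j = q → ∃ l, j = l + 1 ∧ A l ∧ B l := by
    rintro rfl
    rcases hiso j hqA hB with h | h
    · have := hqm _ h.1
      omega
    · exact h
  have hAlt : ∀ k < p, A k := fun k hk => (hcover k (by omega)).resolve_right fun h => by
    have := hp k h
    omega
  have hBgt : ∀ k, q < k → k < n → B k := fun k hk hk' =>
    (hcover k hk').resolve_left fun h => by
      have := hqm k h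
      omega
  apply PrefixData.bruhatLE_perm
  · rintro k hk (h | h | rfl | ⟨rfl, h⟩)
    · exact Or.inr (Or.inl h)
    · exact Or.inr (Or.inr (Or.inl h))
    · exact Or.inl hA
    · rcases lt_or_eq_of_le h with h1 | h1
      · rcases lt_or_eq_of_le (Nat.succ_le_of_lt h1) with h2 | h2
        · exact Or.inl (hAlt _ h2)
        · exact Or.inr (Or.inr (Or.inr h2))
      · exact Or.inl (hi1 h1).1
  · rintro k hk (h | h | rfl | ⟨rfl, h⟩)
    · exact Or.inr (Or.inl h)
    · exact Or.inr (Or.inr (Or.inl h))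
    · exact Or.inl hB
    · rcases lt_or_eq_of_le h with h1 | h1
      · rcases lt_or_eq_of_le (Nat.le_of_lt_succ h1) with h2 | h2
        · exact Or.inl (hBgt _ h2 hk)
        · exact Or.inr (Or.inr (Or.inr h2.symm))
      · obtain ⟨l, hl, h2⟩ := hj1 h1.symm
        obtain rfl : k = l := by omega
        exact Or.inl h2.2
  · rintro k hk (h | h | ⟨rfl, h⟩ | ⟨rfl, h⟩)
    · exact Or.inl (by omega)
    · omega
    · rcases lt_or_eq_of_le h with h1 | h1
      · exact Or.inl h1
      · exact Or.inr (Or.inr ⟨i, rfl, ⟨hA, h1 ▸ hpB⟩, hi1 h1⟩)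
    · rcases lt_or_eq_of_le h with h1 | h1
      · exact Or.inr (Or.inl h1)
      · obtain ⟨l, hl, h2⟩ := hj1 h1.symm
        exact Or.inr (Or.inr ⟨l, hl, h2, h1 ▸ hqA, hB⟩)

theorem bruhatLE_vertexData_topData {n p q i j : ℕ} (hpq : p < q) (hq : q < n) (hi : i ≤ q)
    (hj : p ≤ j) (hjn : j < n) (hij : i ≠ j) :
    BruhatLE (vertexData hpq hq hi hj hjn hij).perm (topData hpq (n := n)).perm := by
  apply PrefixData.bruhatLE_perm
  · rintro k - (h | h)
    · exact Or.inl h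
    · exact Or.inr (Or.inl h)
  · rintro k - (h | h)
    · exact Or.inl h
    · exact Or.inr (Or.inl h)
  · rintro k - (h | h)
    · exact Or.inl h
    · exact Or.inr (Or.inl h)

theorem hollowVec_eq {n : ℕ} {x : Equiv.Perm (Fin n)} {i j : Fin n} (hi : (x i : ℕ) = 0)
    (hj : (x j : ℕ) = n - 1) :
    hollowVec x = fun k => (if k = j then (1 : ℝ) else 0) - (if k = i then 1 else 0) := by
  funext k
  have h1 : (x k : ℕ) = n - 1 ↔ k = j := by
    rw [← hj, ← Fin.ext_iff, x.injective.eq_iff]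
  have h2 : (x k : ℕ) = 0 ↔ k = i := by
    rw [← hi, ← Fin.ext_iff, x.injective.eq_iff]
  simp only [hollowVec, h1, h2]

/-- Let `α ∈ {+,−,*}ⁿ` (no `0` entries) have at least two `*`
entries and no isolated `*` (every starred position has a starred neighbour).  Then
`P_α = conv{e_j − e_i : αᵢ ∈ {−,*}, α_j ∈ {+,*}, i ≠ j}` is a hollow Bruhat
polytope: there exist `u ≤ v` in `Symₙ` with `v` a minimal coset representative
(values `2,…,n−1` ascending in one-line notation) such that `P_α` is the convex
hull of the vectors `hollowVec x` for `x` in the Bruhat interval `[u,v]`. -/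
theorem stmt8 (n : ℕ) (α : Fin n → HollowSymbol)
    (hnozero : ∀ i, α i ≠ zero)
    (hstars : 2 ≤ (Finset.univ.filter fun i => α i = star).card)
    (hiso : ∀ i : Fin n, α i = star →
      ∃ j : Fin n, ((j : ℕ) + 1 = (i : ℕ) ∨ (i : ℕ) + 1 = (j : ℕ)) ∧ α j = star) :
    ∃ u v : Equiv.Perm (Fin n), BruhatLE u v ∧ IsHollowMinRep v ∧
      convexHull ℝ
        {f | ∃ i j : Fin n, (α i = minus ∨ α i = star) ∧ (α j = plus ∨ α j = star) ∧
          i ≠ j ∧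
          f = fun k => (if k = j then (1 : ℝ) else 0) - (if k = i then 1 else 0)} =
      convexHull ℝ (hollowVec '' {x | BruhatLE u x ∧ BruhatLE x v}) := by
  classical
  set A : ℕ → Prop := fun k => ∃ h : k < n, α ⟨k, h⟩ = minus ∨ α ⟨k, h⟩ = star with hAdef
  set B : ℕ → Prop := fun k => ∃ h : k < n, α ⟨k, h⟩ = plus ∨ α ⟨k, h⟩ = star with hBdef
  have hA : ∀ i : Fin n, (α i = minus ∨ α i = star) ↔ A i := fun i => by simp [hAdef]
  have hB : ∀ i : Fin n, (α i = plus ∨ α i = star) ↔ B i := fun i => by simp [hBdef]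
  have hAB : ∀ k, A k → B k → ∃ h : k < n, α ⟨k, h⟩ = star := by
    rintro k ⟨h, h1⟩ ⟨_, h2⟩
    refine ⟨h, ?_⟩
    rcases h1 with h1 | h1
    · simp [h1] at h2
    · exact h1
  have hcover : ∀ k < n, A k ∨ B k := by
    intro k hk
    have h0 := hnozero ⟨k, hk⟩
    rw [← hA ⟨k, hk⟩, ← hB ⟨k, hk⟩]
    cases h : α ⟨k, hk⟩ <;> simp [h] at h0 ⊢
  obtain ⟨s, hs, t, ht, hst⟩ := Finset.one_lt_card.mp hstars
  simp only [Finset.mem_filter, Finset.mem_univ, true_and] at hs ht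
  wlog hlt : s < t generalizing s t
  · exact this t s hst.symm ht hs (lt_of_le_of_ne (not_lt.mp hlt) hst.symm)
  have hiso' : ∀ k, A k → B k → A (k + 1) ∧ B (k + 1) ∨ ∃ l, k = l + 1 ∧ A l ∧ B l := by
    intro k h1 h2
    obtain ⟨hk, h3⟩ := hAB k h1 h2
    obtain ⟨j, hj | hj, hj'⟩ := hiso _ h3
    · exact Or.inr ⟨j, hj.symm, (hA j).mp (Or.inr hj'), (hB j).mp (Or.inr hj')⟩
    · have e : k + 1 = j := hj
      rw [e]
      exact Or.inl ⟨(hA j).mp (Or.inr hj'), (hB j).mp (Or.inr hj')⟩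
  obtain ⟨p, hpB, hp⟩ : ∃ p, B p ∧ ∀ k, B k → p ≤ k :=
    ⟨_, Nat.find_spec (⟨s, (hB s).mp (Or.inr hs)⟩ : ∃ k, B k), fun k hk => Nat.find_min' _ hk⟩
  obtain ⟨q, hqA, hqm⟩ : ∃ q, A q ∧ ∀ k, A k → k ≤ q :=
    ⟨_, Nat.findGreatest_spec (P := A) t.2.le ((hA t).mp (Or.inr ht)),
      fun k hk => Nat.le_findGreatest hk.1.le hk⟩
  have hq : q < n := hqA.1
  have hpq : p < q := by
    have h1 := hp s ((hB s).mp (Or.inr hs))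
    have h2 := hqm t ((hA t).mp (Or.inr ht))
    have h3 : (s : ℕ) < t := hlt
    omega
  have hupper := fun {i j : ℕ} (hi : A i) (hj : B j) (hij : i ≠ j) =>
    bruhatLE_vertexData_topData hpq hq (hqm i hi) (hp j hj) hj.1 hij
  have hlower := fun {i j : ℕ} (hi : A i) (hj : B j) (hij : i ≠ j) =>
    bruhatLE_bottomData_vertexData hpq hq hqA hpB hiso' hcover hp hqm hi hj hj.1 hij
  refine ⟨(bottomData A B hpq hq hqA hiso').perm, (topData hpq).perm,
    (hlower hqA hpB hpq.ne').trans (hupper hqA hpB hpq.ne'), isHollowMinRep_topData hpq hq, ?_⟩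
  congr 1
  ext f
  constructor
  · rintro ⟨i, j, hi, hj, hij, rfl⟩
    rw [hA] at hi
    rw [hB] at hj
    have hij' : (i : ℕ) ≠ j := fun e => hij (Fin.ext e)
    exact ⟨_, ⟨hlower hi hj hij', hupper hi hj hij'⟩,
      hollowVec_eq (vertexData_val_left hpq hq _ _ _ _) (vertexData_val_right hpq hq _ _ _ _)⟩
  · rintro ⟨x, ⟨hux, hxv⟩, rfl⟩
    have hi : (x (x.symm ⟨0, by omega⟩) : ℕ) = 0 := by rw [x.apply_symm_apply]
    have hj : (x (x.symm ⟨n - 1, by omega⟩) : ℕ) = n - 1 := by rw [x.apply_symm_apply]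
    refine ⟨_, _, (hA _).mpr (mem_left_of_interval hpq hq hqA hiso' hcover hp hux.prefixRank_le
      hxv.prefixRank_le _ hi), (hB _).mpr (mem_right_of_interval hpq hq hqA hpB hiso' hcover hqm
      hux.prefixRank_le hxv.prefixRank_le _ hj), fun e => ?_, hollowVec_eq hi hj⟩
    rw [e, hj] at hi
    omega
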